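/- For every integer n ≥ 1, a(n) = (1/256)·(−1)^n·(2n − 7)·(n^2 − 7n + 13) + (1/322560)·(7n^{12} + 42n^{11} − 945n^{10} + 1274n^9 + 26089n^8 − 128810n^7 + 175693n^6 + 205366n^5 − 810796n^4 + 601328n^3 + 354172n^2 − 582180n + 114660). -/

import Mathlib

/-- `a194478 n` is the number of 6-element subsets of the triangular grid
`T_n = {(i,j) : 1 ≤ j ≤ i ≤ n}` such that no three of the chosen points lie on a
common row (equal first coordinate), common diagonal (equal second coordinate),
or common antidiagonal (equal difference `i - j`) (OEIS A194478). -/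
noncomputable def a194478 (n : ℕ) : ℕ :=
  Nat.card {S : Finset (ℕ × ℕ) //
    S.card = 6 ∧ (∀ p ∈ S, 1 ≤ p.2 ∧ p.2 ≤ p.1 ∧ p.1 ≤ n) ∧
    (∀ p ∈ S, ∀ q ∈ S, ∀ r ∈ S, p ≠ q → p ≠ r → q ≠ r →
      ¬(p.1 = q.1 ∧ q.1 = r.1) ∧ ¬(p.2 = q.2 ∧ q.2 = r.2) ∧
      ¬(p.1 - p.2 = q.1 - q.2 ∧ q.1 - q.2 = r.1 - r.2))}

section GridCount

open Finset

section Collinear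

variable {α : Type*}

/-- The points of `S` at which `f` takes the value `i`. -/
def fiber (f : α → ℕ) (S : Finset α) (i : ℕ) : Finset α := S.filter fun p => f p = i

/-- The `k`-element subsets of `S` on which `f` is constant. -/
def coll (f : α → ℕ) (k : ℕ) (S : Finset α) : Finset (Finset α) :=
  (S.powersetCard k).filter fun T => ∀ p ∈ T, ∀ q ∈ T, f p = f q

/-- Ordered pairs of 3-element subsets of `S` lying on two different lines of the direction `f`. -/
def collPairs (f : α → ℕ) (S : Finset α) : Finset (Finset α × Finset α) :=
  (coll f 3 S ×ˢ coll f 3 S).filter fun A => ∀ p ∈ A.1, ∀ q ∈ A.2, f p ≠ f q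

lemma mem_coll {f : α → ℕ} {k : ℕ} {S T : Finset α} :
    T ∈ coll f k S ↔ T ⊆ S ∧ #T = k ∧ ∀ p ∈ T, ∀ q ∈ T, f p = f q := by
  simp [coll, and_assoc]

lemma mem_fiber {f : α → ℕ} {S : Finset α} {i : ℕ} {p : α} :
    p ∈ fiber f S i ↔ p ∈ S ∧ f p = i := by simp [fiber]

/-- Two points agreeing in both directions `f` and `g` coincide. -/
def JointInj (f g : α → ℕ) (S : Finset α) : Prop :=
  ∀ p ∈ S, ∀ q ∈ S, f p = f q → g p = g q → p = q

lemma JointInj.mono {f g : α → ℕ} {S P : Finset α} (h : JointInj f g P) (hS : S ⊆ P) :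
    JointInj f g S := fun p hp q hq => h p (hS hp) q (hS hq)

lemma JointInj.symm {f g : α → ℕ} {S : Finset α} (h : JointInj f g S) : JointInj g f S :=
  fun p hp q hq hg hf => h p hp q hq hf hg

lemma pairwiseDisjoint_powersetCard_fiber (f : α → ℕ) {k : ℕ} (hk : 1 ≤ k) (S : Finset α)
    (I : Finset ℕ) :
    (I : Set ℕ).PairwiseDisjoint fun i => (fiber f S i).powersetCard k := by
  intro i _ j _ hij
  refine disjoint_left.2 fun T hi hj => ?_
  rw [mem_powersetCard] at hi hj
  obtain ⟨p, hp⟩ : T.Nonempty := card_pos.1 (by omega)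
  exact hij ((mem_fiber.1 (hi.1 hp)).2.symm.trans (mem_fiber.1 (hj.1 hp)).2)

variable [DecidableEq α]

lemma coll_eq_biUnion {f : α → ℕ} {k : ℕ} (hk : 1 ≤ k) {S : Finset α} {I : Finset ℕ}
    (hI : ∀ p ∈ S, f p ∈ I) :
    coll f k S = I.biUnion fun i => (fiber f S i).powersetCard k := by
  ext T
  simp only [mem_coll, mem_biUnion, mem_powersetCard]
  constructor
  · rintro ⟨hT, hc, h⟩
    obtain ⟨p, hp⟩ : T.Nonempty := card_pos.1 (by omega)
    exact ⟨f p, hI p (hT hp), fun q hq => mem_fiber.2 ⟨hT hq, h q hq p hp⟩, hc⟩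
  · rintro ⟨i, -, hT, hc⟩
    exact ⟨fun q hq => (mem_fiber.1 (hT hq)).1, hc, fun p hp q hq =>
      (mem_fiber.1 (hT hp)).2.trans (mem_fiber.1 (hT hq)).2.symm⟩

lemma sum_coll {M : Type*} [AddCommMonoid M] {f : α → ℕ} {k : ℕ} (hk : 1 ≤ k) {S : Finset α}
    {I : Finset ℕ} (hI : ∀ p ∈ S, f p ∈ I) (F : Finset α → M) :
    ∑ T ∈ coll f k S, F T = ∑ i ∈ I, ∑ T ∈ (fiber f S i).powersetCard k, F T := by
  rw [coll_eq_biUnion hk hI, sum_biUnion (pairwiseDisjoint_powersetCard_fiber f hk S I)]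

lemma card_coll {f : α → ℕ} {k : ℕ} (hk : 1 ≤ k) {S : Finset α} {I : Finset ℕ}
    (hI : ∀ p ∈ S, f p ∈ I) :
    #(coll f k S) = ∑ i ∈ I, (#(fiber f S i)).choose k := by
  simp only [card_eq_sum_ones, sum_coll hk hI]
  simp

lemma card_collPairs {f : α → ℕ} {S : Finset α} {I : Finset ℕ} (hI : ∀ p ∈ S, f p ∈ I) :
    #(collPairs f S) + ∑ i ∈ I, (#(fiber f S i)).choose 3 ^ 2 = #(coll f 3 S) ^ 2 := by
  have h : #((coll f 3 S ×ˢ coll f 3 S).filter fun A => ¬ ∀ p ∈ A.1, ∀ q ∈ A.2, f p ≠ f q) =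
      ∑ i ∈ I, (#(fiber f S i)).choose 3 ^ 2 := by
    rw [card_filter, sum_product, sum_coll (by norm_num) hI]
    refine sum_congr rfl fun i hi => ?_
    rw [sum_congr rfl (g := fun _ => (#(fiber f S i)).choose 3)]
    · simp [sq]
    intro T hT
    rw [← card_filter, ← card_powersetCard]
    congr 1
    ext T'
    simp only [mem_filter, mem_coll, mem_powersetCard] at hT ⊢
    obtain ⟨p, hp⟩ : T.Nonempty := card_pos.1 (by omega)
    have hpi := (mem_fiber.1 (hT.1 hp)).2
    constructor
    · rintro ⟨⟨h1, h2, h3⟩, h4⟩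
      push Not at h4
      obtain ⟨a, ha, b, hb, hab⟩ := h4
      have hai := (mem_fiber.1 (hT.1 ha)).2
      exact ⟨fun c hc => mem_fiber.2 ⟨h1 hc, by rw [h3 c hc b hb, ← hab, hai]⟩, h2⟩
    · rintro ⟨h1, h2⟩
      obtain ⟨q, hq⟩ : T'.Nonempty := card_pos.1 (by omega)
      refine ⟨⟨fun c hc => (mem_fiber.1 (h1 hc)).1, h2, fun a ha b hb => ?_⟩, fun h => ?_⟩
      · rw [(mem_fiber.1 (h1 ha)).2, (mem_fiber.1 (h1 hb)).2]
      · exact h p hp q hq (hpi.trans (mem_fiber.1 (h1 hq)).2.symm)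
  rw [← h, collPairs, card_filter_add_card_filter_not, card_product, sq]

lemma sum_choose_eq_zero {I : Finset ℕ} {c : ℕ → ℕ} {k : ℕ} (hk : 3 ≤ k)
    (h : ∀ i ∈ I, c i ≤ 2) : ∑ i ∈ I, (c i).choose k = 0 :=
  sum_eq_zero fun i hi => Nat.choose_eq_zero_of_lt (by have := h i hi; omega)

lemma sum_choose_sq_eq_zero {I : Finset ℕ} {c : ℕ → ℕ}
    (h : ∀ i ∈ I, c i ≤ 2) : ∑ i ∈ I, (c i).choose 3 ^ 2 = 0 :=
  sum_eq_zero fun i hi => by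
    rw [Nat.choose_eq_zero_of_lt (by have := h i hi; omega)]; rfl

/-- Inclusion-exclusion for the condition that all parts of a composition of 6 are at most 2. -/
lemma good_composition (I : Finset ℕ) (c : ℕ → ℕ) (hc : ∑ i ∈ I, c i = 6) :
    (if ∀ i ∈ I, c i ≤ 2 then (1 : ℚ) else 0) =
      1 - (∑ i ∈ I, (c i).choose 3 : ℕ) + 3 * (∑ i ∈ I, (c i).choose 4 : ℕ)
        - 6 * (∑ i ∈ I, (c i).choose 5 : ℕ) + 10 * (∑ i ∈ I, (c i).choose 6 : ℕ)
        + (((∑ i ∈ I, (c i).choose 3 : ℕ) : ℚ) ^ 2 - (∑ i ∈ I, (c i).choose 3 ^ 2 : ℕ)) / 2 := by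
  by_cases h : ∀ i ∈ I, c i ≤ 2
  · rw [if_pos h, sum_choose_eq_zero le_rfl h, sum_choose_eq_zero (by norm_num) h,
      sum_choose_eq_zero (by norm_num) h, sum_choose_eq_zero (by norm_num) h,
      sum_choose_sq_eq_zero h]
    norm_num
  rw [if_neg h]
  push Not at h
  obtain ⟨i, hi, hci⟩ := h
  rw [← add_sum_erase I _ hi] at hc
  have hle : ∀ j ∈ I.erase i, c j ≤ 6 - c i := fun j hj => by
    have := single_le_sum (f := c) (fun _ _ => Nat.zero_le _) hj
    omega
  simp only [← add_sum_erase I _ hi]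
  by_cases h2 : ∀ j ∈ I.erase i, c j ≤ 2
  · rw [sum_choose_eq_zero le_rfl h2, sum_choose_eq_zero (by norm_num) h2,
      sum_choose_eq_zero (by norm_num) h2, sum_choose_eq_zero (by norm_num) h2,
      sum_choose_sq_eq_zero h2]
    have : c i ≤ 6 := by omega
    interval_cases c i <;> norm_num [Nat.choose]
  · push Not at h2
    obtain ⟨j, hj, hcj⟩ := h2
    have hj' := hle j hj
    have e1 : c i = 3 := by omega
    have e2 : c j = 3 := by omega
    rw [← add_sum_erase _ _ hj] at hc
    simp only [← add_sum_erase _ _ hj]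
    have h3 : ∀ k ∈ (I.erase i).erase j, c k ≤ 2 := fun k hk => by
      have := single_le_sum (f := c) (fun _ _ => Nat.zero_le _) hk
      omega
    rw [sum_choose_eq_zero le_rfl h3, sum_choose_eq_zero (by norm_num) h3,
      sum_choose_eq_zero (by norm_num) h3, sum_choose_eq_zero (by norm_num) h3,
      sum_choose_sq_eq_zero h3, e1, e2]
    norm_num [Nat.choose]

/-- No line of the direction `f` contains three points of `S`. -/
def Good (f : α → ℕ) (S : Finset α) : Prop := ∀ i, #(fiber f S i) ≤ 2

/-- The correction term in the inclusion-exclusion formula for `Good`. -/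
def defect (f : α → ℕ) (S : Finset α) : ℚ :=
  -(#(coll f 3 S) : ℚ) + 3 * #(coll f 4 S) - 6 * #(coll f 5 S) + 10 * #(coll f 6 S)
    + #(collPairs f S) / 2

open Classical in
lemma good_eq (f : α → ℕ) {S : Finset α} (hS : #S = 6) :
    (if Good f S then (1 : ℚ) else 0) = 1 + defect f S := by
  have hI : ∀ p ∈ S, f p ∈ S.image f := fun p hp => mem_image_of_mem f hp
  have hsum : ∑ i ∈ S.image f, #(fiber f S i) = 6 := by
    rw [← hS]; exact (card_eq_sum_card_fiberwise hI).symm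
  have hiff : Good f S ↔ ∀ i ∈ S.image f, #(fiber f S i) ≤ 2 := by
    refine ⟨fun h i _ => h i, fun h i => ?_⟩
    by_cases hi : i ∈ S.image f
    · exact h i hi
    · rw [card_eq_zero.2]
      · norm_num
      · refine eq_empty_of_forall_notMem fun p hp => hi ?_
        rw [← (mem_fiber.1 hp).2]
        exact hI p (mem_fiber.1 hp).1
  have hp : (#(collPairs f S) : ℚ) = (#(coll f 3 S) : ℚ) ^ 2 -
      (∑ i ∈ S.image f, (#(fiber f S i)).choose 3 ^ 2 : ℕ) := by
    rw [eq_sub_iff_add_eq]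
    exact_mod_cast card_collPairs hI
  rw [if_congr hiff rfl rfl, good_composition _ _ hsum, defect, hp]
  rw [← card_coll (by norm_num) hI, ← card_coll (by norm_num) hI, ← card_coll (by norm_num) hI,
    ← card_coll (by norm_num) hI]
  ring

lemma JointInj.card_inter_le {f g : α → ℕ} {S T U : Finset α} {k l : ℕ} (h : JointInj f g S)
    (hT : T ∈ coll f k S) (hU : U ∈ coll g l S) : #(T ∩ U) ≤ 1 := by
  rw [mem_coll] at hT hU
  refine card_le_one.2 fun p hp q hq => ?_
  rw [mem_inter] at hp hq
  exact h p (hT.1 hp.1) q (hT.1 hq.1) (hT.2.2 p hp.1 q hq.1) (hU.2.2 p hp.2 q hq.2)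

lemma JointInj.card_coll_mul_eq_zero {f g : α → ℕ} {S : Finset α} (h : JointInj f g S)
    (hS : #S = 6) {k l : ℕ} (hkl : 8 ≤ k + l) :
    (#(coll f k S) : ℚ) * #(coll g l S) = 0 := by
  by_contra hne
  have h0 : #(coll f k S) ≠ 0 ∧ #(coll g l S) ≠ 0 := by
    constructor <;> intro h0 <;> simp [h0] at hne
  obtain ⟨T, hT⟩ := card_ne_zero.1 h0.1
  obtain ⟨U, hU⟩ := card_ne_zero.1 h0.2
  have h1 := h.card_inter_le hT hU
  have h2 := card_union_add_card_inter T U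
  rw [mem_coll] at hT hU
  have h3 := card_le_card (union_subset hT.1 hU.1)
  omega

lemma JointInj.card_collPairs_mul_eq_zero {f g : α → ℕ} {S : Finset α} (h : JointInj f g S)
    (hS : #S = 6) {k : ℕ} (hk : 3 ≤ k) :
    (#(collPairs f S) : ℚ) * #(coll g k S) = 0 := by
  by_contra hne
  have h0 : #(collPairs f S) ≠ 0 ∧ #(coll g k S) ≠ 0 := by
    constructor <;> intro h0 <;> simp [h0] at hne
  obtain ⟨⟨T, T'⟩, hT⟩ := card_ne_zero.1 h0.1
  obtain ⟨U, hU⟩ := card_ne_zero.1 h0.2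
  simp only [collPairs, mem_filter, mem_product] at hT
  obtain ⟨⟨hT, hT'⟩, hd⟩ := hT
  have h1 := h.card_inter_le hT hU
  have h2 := h.card_inter_le hT' hU
  rw [mem_coll] at hT hT' hU
  have hdis : Disjoint T T' := disjoint_left.2 fun p hp hp' => hd p hp p hp' rfl
  have hTS : T ∪ T' = S := eq_of_subset_of_card_le (union_subset hT.1 hT'.1)
    (by rw [card_union_of_disjoint hdis]; omega)
  have hU' : U = (T ∩ U) ∪ (T' ∩ U) := by
    rw [← union_inter_distrib_right, hTS, inter_eq_right.2 hU.1]
  have h3 := card_union_le (T ∩ U) (T' ∩ U)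
  rw [← hU'] at h3
  omega

lemma collPairs_mul_collPairs_eq_zero {f g : α → ℕ} {S : Finset α} (h : JointInj f g S)
    (hS : #S = 6) : (#(collPairs f S) : ℚ) * #(collPairs g S) = 0 := by
  rcases mul_eq_zero.1 (h.card_collPairs_mul_eq_zero hS le_rfl) with h0 | h0
  · rw [h0, zero_mul]
  · have h1 : #(collPairs g S) ≤ #(coll g 3 S ×ˢ coll g 3 S) := card_filter_le _ _
    rw [card_product, Nat.cast_eq_zero.1 h0] at h1
    rw [Nat.le_zero.1 h1, Nat.cast_zero, mul_zero]

lemma JointInj.defect_mul_defect {f g : α → ℕ} {S : Finset α} (h : JointInj f g S)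
    (hS : #S = 6) :
    defect f S * defect g S = (#(coll f 3 S) : ℚ) * #(coll g 3 S)
      - 3 * (#(coll f 3 S) * #(coll g 4 S)) - 3 * (#(coll f 4 S) * #(coll g 3 S)) := by
  have z : ∀ k l, 8 ≤ k + l → (#(coll f k S) : ℚ) * #(coll g l S) = 0 :=
    fun k l => h.card_coll_mul_eq_zero hS
  have y : ∀ k, 3 ≤ k → (#(collPairs f S) : ℚ) * #(coll g k S) = 0 :=
    fun k => h.card_collPairs_mul_eq_zero hS
  have y' : ∀ k, 3 ≤ k → (#(collPairs g S) : ℚ) * #(coll f k S) = 0 :=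
    fun k => h.symm.card_collPairs_mul_eq_zero hS
  have w := collPairs_mul_collPairs_eq_zero h hS
  have z35 := z 3 5 (by norm_num)
  have z36 := z 3 6 (by norm_num)
  have z44 := z 4 4 (by norm_num)
  have z45 := z 4 5 (by norm_num)
  have z46 := z 4 6 (by norm_num)
  have z53 := z 5 3 (by norm_num)
  have z54 := z 5 4 (by norm_num)
  have z55 := z 5 5 (by norm_num)
  have z56 := z 5 6 (by norm_num)
  have z63 := z 6 3 (by norm_num)
  have z64 := z 6 4 (by norm_num)
  have z65 := z 6 5 (by norm_num)
  have z66 := z 6 6 (by norm_num)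
  have y3 := y 3 (by norm_num)
  have y4 := y 4 (by norm_num)
  have y5 := y 5 (by norm_num)
  have y6 := y 6 (by norm_num)
  have x3 := y' 3 (by norm_num)
  have x4 := y' 4 (by norm_num)
  have x5 := y' 5 (by norm_num)
  have x6 := y' 6 (by norm_num)
  unfold defect
  linear_combination 6 * z35 - 10 * z36 + 9 * z44 - 18 * z45 + 30 * z46 + 6 * z53 - 18 * z54
    + 36 * z55 - 60 * z56 - 10 * z63 + 30 * z64 - 60 * z65 + 100 * z66
    - y3 / 2 + 3 / 2 * y4 - 3 * y5 + 5 * y6 - x3 / 2 + 3 / 2 * x4 - 3 * x5 + 5 * x6 + w / 4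

lemma card_union_three_add (T U V : Finset α) :
    #(T ∪ U ∪ V) + #(T ∩ U) + #(T ∩ V) + #(U ∩ V) = #T + #U + #V + #(T ∩ U ∩ V) := by
  have h1 := card_union_add_card_inter (T ∪ U) V
  have h2 := card_union_add_card_inter T U
  have h3 := card_union_add_card_inter (T ∩ V) (U ∩ V)
  rw [← union_inter_distrib_right] at h3
  have h4 : T ∩ V ∩ (U ∩ V) = T ∩ U ∩ V := by
    ext; simp only [mem_inter]; tauto
  rw [h4] at h3
  omega

lemma coll_mul_coll_mul_coll_eq_zero {f g h : α → ℕ} {S : Finset α} (hfg : JointInj f g S)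
    (hfh : JointInj f h S) (hgh : JointInj g h S) (hS : #S = 6) {k l r : ℕ}
    (hklr : 10 ≤ k + l + r) :
    (#(coll f k S) : ℚ) * #(coll g l S) * #(coll h r S) = 0 := by
  by_contra hne
  have h0 : #(coll f k S) ≠ 0 ∧ #(coll g l S) ≠ 0 ∧ #(coll h r S) ≠ 0 := by
    refine ⟨?_, ?_, ?_⟩ <;> intro h0 <;> simp [h0] at hne
  obtain ⟨T, hT⟩ := card_ne_zero.1 h0.1
  obtain ⟨U, hU⟩ := card_ne_zero.1 h0.2.1
  obtain ⟨V, hV⟩ := card_ne_zero.1 h0.2.2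
  have h1 := hfg.card_inter_le hT hU
  have h2 := hfh.card_inter_le hT hV
  have h3 := hgh.card_inter_le hU hV
  have h4 := card_union_three_add T U V
  rw [mem_coll] at hT hU hV
  have h5 := card_le_card (union_subset (union_subset hT.1 hU.1) hV.1)
  omega

lemma defect_mul_defect_mul_defect {f g h : α → ℕ} {S : Finset α} (hfg : JointInj f g S)
    (hfh : JointInj f h S) (hgh : JointInj g h S) (hS : #S = 6) :
    defect f S * defect g S * defect h S =
      -((#(coll f 3 S) : ℚ) * #(coll g 3 S) * #(coll h 3 S)) := by
  have z : ∀ k l r, 10 ≤ k + l + r → (#(coll f k S) : ℚ) * #(coll g l S) * #(coll h r S) = 0 :=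
    fun k l r => coll_mul_coll_mul_coll_eq_zero hfg hfh hgh hS
  have y : (#(collPairs h S) : ℚ) * #(coll f 3 S) = 0 :=
    hfh.symm.card_collPairs_mul_eq_zero hS le_rfl
  have x : (#(collPairs h S) : ℚ) * #(coll f 4 S) = 0 :=
    hfh.symm.card_collPairs_mul_eq_zero hS (by norm_num)
  have z334 := z 3 3 4 (by norm_num)
  have z335 := z 3 3 5 (by norm_num)
  have z336 := z 3 3 6 (by norm_num)
  have z343 := z 3 4 3 (by norm_num)
  have z344 := z 3 4 4 (by norm_num)
  have z345 := z 3 4 5 (by norm_num)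
  have z346 := z 3 4 6 (by norm_num)
  have z433 := z 4 3 3 (by norm_num)
  have z434 := z 4 3 4 (by norm_num)
  have z435 := z 4 3 5 (by norm_num)
  have z436 := z 4 3 6 (by norm_num)
  rw [hfg.defect_mul_defect hS, defect]
  linear_combination 3 * z334 - 6 * z335 + 10 * z336 + 3 * z343 - 9 * z344 + 18 * z345 - 30 * z346
    + 3 * z433 - 9 * z434 + 18 * z435 - 30 * z436
    + (#(coll g 3 S) - 3 * #(coll g 4 S) : ℚ) / 2 * y - 3 / 2 * #(coll g 3 S) * x

end Collinear

section Sums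

variable {α : Type*} [DecidableEq α]

lemma sum_card_filter_subset {β : Type*} (P : Finset α) (Q : Finset β) (U : β → Finset α)
    (hU : ∀ b ∈ Q, U b ⊆ P) :
    ∑ S ∈ P.powersetCard 6, #(Q.filter fun b => U b ⊆ S) =
      ∑ b ∈ Q, if #(U b) ≤ 6 then (#P - #(U b)).choose (6 - #(U b)) else 0 := by
  simp only [card_filter]
  rw [sum_comm]
  refine sum_congr rfl fun b hb => ?_
  rw [← card_filter]
  split_ifs with h
  · exact card_filter_powersetCard_subset _ _ _ (hU b hb) h
  · refine card_eq_zero.2 (filter_eq_empty_iff.2 fun S hS hb => h ?_)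
    rw [← (mem_powersetCard.1 hS).2]
    exact card_le_card hb

lemma coll_eq_filter (f : α → ℕ) (k : ℕ) {S P : Finset α} (hS : S ⊆ P) :
    coll f k S = (coll f k P).filter fun T => T ⊆ S := by
  ext T
  simp only [mem_coll, mem_filter]
  exact ⟨fun h => ⟨⟨h.1.trans hS, h.2⟩, h.1⟩, fun h => ⟨h.2, h.1.2⟩⟩

lemma sum_card_coll (f : α → ℕ) {k : ℕ} (hk : k ≤ 6) (P : Finset α) :
    ∑ S ∈ P.powersetCard 6, #(coll f k S) = #(coll f k P) * (#P - k).choose (6 - k) := by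
  rw [sum_congr rfl fun S hS => by rw [coll_eq_filter f k (mem_powersetCard.1 hS).1],
    sum_card_filter_subset P (coll f k P) (fun T => T) fun T hT => (mem_coll.1 hT).1]
  rw [sum_congr rfl (g := fun _ => (#P - k).choose (6 - k)) fun T hT => by
    rw [(mem_coll.1 hT).2.1, if_pos hk]]
  simp

lemma sum_card_collPairs (f : α → ℕ) (P : Finset α) :
    ∑ S ∈ P.powersetCard 6, #(collPairs f S) = #(collPairs f P) := by
  have h : ∀ S ∈ P.powersetCard 6,
      #(collPairs f S) = #((collPairs f P).filter fun A => A.1 ∪ A.2 ⊆ S) := by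
    intro S hS
    congr 1
    ext A
    simp only [collPairs, coll_eq_filter f 3 (mem_powersetCard.1 hS).1, mem_filter, mem_product,
      union_subset_iff]
    tauto
  rw [sum_congr rfl h, sum_card_filter_subset, sum_congr rfl (g := fun _ => 1)]
  · simp
  · intro A hA
    simp only [collPairs, mem_filter, mem_product, mem_coll] at hA
    rw [card_union_of_disjoint (disjoint_left.2 fun p hp hp' => hA.2 p hp p hp' rfl),
      hA.1.1.2.1, hA.1.2.2.1]
    simp
  · intro A hA
    simp only [collPairs, mem_filter, mem_product, mem_coll] at hA
    exact union_subset hA.1.1.1 hA.1.2.1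

/-- The number of incidences between collinear `k`-sets in direction `f` and collinear `l`-sets
in direction `g`. -/
def crossings (f g : α → ℕ) (k l : ℕ) (P : Finset α) : ℕ :=
  ∑ A ∈ coll f k P ×ˢ coll g l P, #(A.1 ∩ A.2)

lemma sum_card_coll_mul (f g : α → ℕ) (k l : ℕ) (P : Finset α) :
    ∑ S ∈ P.powersetCard 6, #(coll f k S) * #(coll g l S) =
      ∑ A ∈ coll f k P ×ˢ coll g l P,
        if #(A.1 ∪ A.2) ≤ 6 then (#P - #(A.1 ∪ A.2)).choose (6 - #(A.1 ∪ A.2)) else 0 := by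
  rw [← sum_card_filter_subset P _ fun A : Finset α × Finset α => A.1 ∪ A.2]
  · refine sum_congr rfl fun S hS => ?_
    rw [← card_product, coll_eq_filter f k (mem_powersetCard.1 hS).1,
      coll_eq_filter g l (mem_powersetCard.1 hS).1, ← filter_product]
    simp only [union_subset_iff]
  · intro A hA
    rw [mem_product, mem_coll, mem_coll] at hA
    exact union_subset hA.1.1 hA.2.1

lemma sum_card_coll_three_mul_three {f g : α → ℕ} {P : Finset α} (h : JointInj f g P)
    (hP : 6 ≤ #P) :
    ((∑ S ∈ P.powersetCard 6, #(coll f 3 S) * #(coll g 3 S) : ℕ) : ℚ) =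
      #(coll f 3 P) * #(coll g 3 P) + (#P - 6) * crossings f g 3 3 P := by
  rw [sum_card_coll_mul, crossings, Nat.cast_sum, Nat.cast_sum, mul_sum, ← Nat.cast_mul,
    ← card_product, card_eq_sum_ones (coll f 3 P ×ˢ coll g 3 P), Nat.cast_sum, ← sum_add_distrib]
  refine sum_congr rfl fun A hA => ?_
  rw [mem_product] at hA
  have h1 := h.card_inter_le hA.1 hA.2
  have h2 := card_union_add_card_inter A.1 A.2
  rw [(mem_coll.1 hA.1).2.1, (mem_coll.1 hA.2).2.1] at h2
  interval_cases h3 : #(A.1 ∩ A.2)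
  · rw [show #(A.1 ∪ A.2) = 6 by omega]
    simp
  · rw [show #(A.1 ∪ A.2) = 5 by omega]
    simp [Nat.cast_sub (show 5 ≤ #P by omega)]
    ring

lemma sum_card_coll_mul_of_add_eq_seven {f g : α → ℕ} {P : Finset α} (h : JointInj f g P)
    {k l : ℕ} (hkl : k + l = 7) :
    ∑ S ∈ P.powersetCard 6, #(coll f k S) * #(coll g l S) = crossings f g k l P := by
  rw [sum_card_coll_mul, crossings]
  refine sum_congr rfl fun A hA => ?_
  rw [mem_product] at hA
  have h1 := h.card_inter_le hA.1 hA.2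
  have h2 := card_union_add_card_inter A.1 A.2
  rw [(mem_coll.1 hA.1).2.1, (mem_coll.1 hA.2).2.1, hkl] at h2
  interval_cases h3 : #(A.1 ∩ A.2)
  · rw [show #(A.1 ∪ A.2) = 7 by omega]
    simp
  · rw [show #(A.1 ∪ A.2) = 6 by omega]
    simp

/-- Triples of collinear 3-sets in the three directions whose union has 6 elements. -/
def triangles (f g h : α → ℕ) (P : Finset α) : Finset (Finset α × Finset α × Finset α) :=
  (coll f 3 P ×ˢ coll g 3 P ×ˢ coll h 3 P).filter fun A => #(A.1 ∪ A.2.1 ∪ A.2.2) = 6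

lemma six_le_card_union {f g h : α → ℕ} {P : Finset α} (hfg : JointInj f g P)
    (hfh : JointInj f h P) (hgh : JointInj g h P) {T U V : Finset α} (hT : T ∈ coll f 3 P)
    (hU : U ∈ coll g 3 P) (hV : V ∈ coll h 3 P) : 6 ≤ #(T ∪ U ∪ V) := by
  have h1 := hfg.card_inter_le hT hU
  have h2 := hfh.card_inter_le hT hV
  have h3 := hgh.card_inter_le hU hV
  have h4 := card_union_three_add T U V
  rw [mem_coll] at hT hU hV
  omega

lemma sum_card_coll_three_mul_three_mul_three {f g h : α → ℕ} {P : Finset α}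
    (hfg : JointInj f g P) (hfh : JointInj f h P) (hgh : JointInj g h P) :
    ∑ S ∈ P.powersetCard 6, #(coll f 3 S) * #(coll g 3 S) * #(coll h 3 S) =
      #(triangles f g h P) := by
  rw [triangles, card_filter]
  trans ∑ A ∈ coll f 3 P ×ˢ coll g 3 P ×ˢ coll h 3 P, if #(A.1 ∪ A.2.1 ∪ A.2.2) ≤ 6 then
    (#P - #(A.1 ∪ A.2.1 ∪ A.2.2)).choose (6 - #(A.1 ∪ A.2.1 ∪ A.2.2)) else 0
  · rw [← sum_card_filter_subset P _ fun A : Finset α × Finset α × Finset α => A.1 ∪ A.2.1 ∪ A.2.2]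
    · refine sum_congr rfl fun S hS => ?_
      have hS' := (mem_powersetCard.1 hS).1
      rw [mul_assoc, ← card_product, ← card_product]
      congr 1
      ext A
      simp only [coll_eq_filter _ 3 hS', mem_filter, mem_product, union_subset_iff]
      tauto
    · intro A hA
      rw [mem_product, mem_product, mem_coll, mem_coll, mem_coll] at hA
      exact union_subset (union_subset hA.1.1 hA.2.1.1) hA.2.2.1
  · refine sum_congr rfl fun A hA => ?_
    rw [mem_product, mem_product] at hA
    have h6 := six_le_card_union hfg hfh hgh hA.1 hA.2.1 hA.2.2
    by_cases h : #(A.1 ∪ A.2.1 ∪ A.2.2) = 6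
    · rw [h]; simp
    · rw [if_neg (by omega), if_neg h]

lemma sum_defect (f : α → ℕ) {P : Finset α} :
    ∑ S ∈ P.powersetCard 6, defect f S =
      -(#(coll f 3 P) * (#P - 3).choose 3 : ℚ) + 3 * (#(coll f 4 P) * (#P - 4).choose 2)
        - 6 * (#(coll f 5 P) * (#P - 5 : ℕ)) + 10 * #(coll f 6 P) + #(collPairs f P) / 2 := by
  have e3 := sum_card_coll f (show 3 ≤ 6 by norm_num) P
  have e4 := sum_card_coll f (show 4 ≤ 6 by norm_num) P
  have e5 := sum_card_coll f (show 5 ≤ 6 by norm_num) P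
  have e6 := sum_card_coll f (show 6 ≤ 6 by norm_num) P
  have ep := sum_card_collPairs f P
  norm_num at e3 e4 e5 e6
  simp only [defect, sum_add_distrib, sum_sub_distrib, sum_neg_distrib, ← mul_sum, ← sum_div,
    ← Nat.cast_sum, e3, e4, e5, e6, ep, Nat.cast_mul]

lemma sum_defect_mul_defect {f g : α → ℕ} {P : Finset α} (h : JointInj f g P) (hP : 6 ≤ #P) :
    ∑ S ∈ P.powersetCard 6, defect f S * defect g S =
      #(coll f 3 P) * #(coll g 3 P) + (#P - 6) * crossings f g 3 3 P
        - 3 * crossings f g 3 4 P - 3 * crossings f g 4 3 P := by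
  rw [← sum_card_coll_three_mul_three h hP, ← sum_card_coll_mul_of_add_eq_seven h (by norm_num),
    ← sum_card_coll_mul_of_add_eq_seven h (by norm_num)]
  push_cast
  rw [mul_sum, mul_sum, ← sum_sub_distrib, ← sum_sub_distrib]
  refine sum_congr rfl fun S hS => ?_
  rw [mem_powersetCard] at hS
  rw [(h.mono hS.1).defect_mul_defect hS.2]

open Classical in
/-- Inclusion-exclusion over the three directions. -/
lemma card_good {f g h : α → ℕ} {P : Finset α} (hfg : JointInj f g P) (hfh : JointInj f h P)
    (hgh : JointInj g h P) :
    (#((P.powersetCard 6).filter fun S => Good f S ∧ Good g S ∧ Good h S) : ℚ) =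
      (#P).choose 6 + (∑ S ∈ P.powersetCard 6, defect f S + ∑ S ∈ P.powersetCard 6, defect g S
        + ∑ S ∈ P.powersetCard 6, defect h S)
        + (∑ S ∈ P.powersetCard 6, defect f S * defect g S
          + ∑ S ∈ P.powersetCard 6, defect h S * defect f S
          + ∑ S ∈ P.powersetCard 6, defect g S * defect h S)
        - #(triangles f g h P) := by
  rw [← sum_card_coll_three_mul_three_mul_three hfg hfh hgh, ← card_powersetCard,
    card_eq_sum_ones (P.powersetCard 6), card_filter]
  push_cast
  simp only [← sum_add_distrib, ← sum_sub_distrib]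
  refine sum_congr rfl fun S hS => ?_
  rw [mem_powersetCard] at hS
  have h3 := defect_mul_defect_mul_defect (hfg.mono hS.1) (hfh.mono hS.1) (hgh.mono hS.1) hS.2
  rw [ite_and, ite_and]
  have e : (if Good f S then if Good g S then if Good h S then (1 : ℚ) else 0 else 0 else 0) =
      (if Good f S then 1 else 0) * (if Good g S then 1 else 0) * (if Good h S then 1 else 0) := by
    split_ifs <;> norm_num
  rw [e, good_eq f hS.2, good_eq g hS.2, good_eq h hS.2]
  linear_combination h3

lemma card_filter_mem_coll (f : α → ℕ) {k : ℕ} (hk : 1 ≤ k) {P : Finset α} {v : α} (hv : v ∈ P) :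
    #((coll f k P).filter fun T => v ∈ T) = (#(fiber f P (f v)) - 1).choose (k - 1) := by
  rw [← card_singleton v, ← card_filter_powersetCard_subset {v} _ k
    (singleton_subset_iff.2 (mem_fiber.2 ⟨hv, rfl⟩)) (by simpa)]
  congr 1
  ext T
  simp only [mem_filter, mem_coll, mem_powersetCard, singleton_subset_iff]
  constructor
  · rintro ⟨⟨h1, h2, h3⟩, h4⟩
    exact ⟨⟨fun q hq => mem_fiber.2 ⟨h1 hq, h3 q hq v h4⟩, h2⟩, h4⟩
  · rintro ⟨⟨h1, h2⟩, h4⟩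
    exact ⟨⟨fun q hq => (mem_fiber.1 (h1 hq)).1, h2, fun p hp q hq =>
      (mem_fiber.1 (h1 hp)).2.trans (mem_fiber.1 (h1 hq)).2.symm⟩, h4⟩

lemma crossings_eq (f g : α → ℕ) {k l : ℕ} (hk : 1 ≤ k) (hl : 1 ≤ l) (P : Finset α) :
    crossings f g k l P = ∑ v ∈ P, (#(fiber f P (f v)) - 1).choose (k - 1) *
      (#(fiber g P (g v)) - 1).choose (l - 1) := by
  rw [sum_congr rfl fun v hv => by
    rw [← card_filter_mem_coll f hk hv, ← card_filter_mem_coll g hl hv, ← card_product,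
      ← filter_product, card_filter], sum_comm, crossings]
  refine sum_congr rfl fun A hA => ?_
  rw [mem_product, mem_coll] at hA
  rw [← card_filter]
  congr 1
  ext v
  simp only [mem_inter, mem_filter]
  exact ⟨fun h => ⟨hA.1.1 h.1, h⟩, fun h => h.2⟩

end Sums

section Simplex

variable {α : Type*}

/-- `f, g, h` are barycentric coordinates identifying `P` with the triangular grid of side `m`. -/
structure IsSimplex (f g h : α → ℕ) (P : Finset α) (m : ℕ) : Prop where
  sum_eq : ∀ p ∈ P, f p + g p + h p = m
  exists_mem : ∀ a b c, a + b + c = m → ∃ p ∈ P, f p = a ∧ g p = b ∧ h p = c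
  inj : ∀ p ∈ P, ∀ q ∈ P, f p = f q → g p = g q → p = q

variable {f g h : α → ℕ} {P : Finset α} {m : ℕ}

lemma IsSimplex.rotate (H : IsSimplex f g h P m) : IsSimplex g h f P m where
  sum_eq p hp := by have := H.sum_eq p hp; omega
  exists_mem a b c habc := by
    obtain ⟨p, hp, h1, h2, h3⟩ := H.exists_mem c a b (by omega)
    exact ⟨p, hp, h2, h3, h1⟩
  inj p hp q hq h1 h2 := by
    have := H.sum_eq p hp
    have := H.sum_eq q hq
    exact H.inj p hp q hq (by omega) h1

lemma IsSimplex.card_fiber (H : IsSimplex f g h P m) (i : ℕ) :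
    #(fiber f P i) = m + 1 - i := by
  rw [← card_range (m + 1 - i)]
  refine card_nbij g ?_ ?_ ?_
  · intro p hp
    rw [mem_coe, mem_fiber] at hp
    have := H.sum_eq p hp.1
    rw [mem_coe, mem_range]
    omega
  · intro p hp q hq hpq
    rw [mem_coe, mem_fiber] at hp hq
    exact H.inj p hp.1 q hq.1 (hp.2.trans hq.2.symm) hpq
  · intro b hb
    rw [mem_coe, mem_range] at hb
    obtain ⟨p, hp, h1, h2, -⟩ := H.exists_mem i b (m - i - b) (by omega)
    exact ⟨p, mem_coe.2 (mem_fiber.2 ⟨hp, h1⟩), h2⟩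

lemma IsSimplex.sum_comp {M : Type*} [AddCommMonoid M] (H : IsSimplex f g h P m)
    (F : ℕ → ℕ → M) :
    ∑ p ∈ P, F (f p) (g p) = ∑ a ∈ range (m + 1), ∑ b ∈ range (m + 1 - a), F a b := by
  rw [sum_sigma']
  refine sum_nbij (fun p => ⟨f p, g p⟩) ?_ ?_ ?_ fun _ _ => rfl
  · intro p hp
    have := H.sum_eq p hp
    simp only [mem_sigma, mem_range]
    omega
  · intro p hp q hq hpq
    simp only [Sigma.mk.injEq, heq_eq_eq] at hpq
    exact H.inj p hp q hq hpq.1 hpq.2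
  · rintro ⟨a, b⟩ hab
    simp only [mem_coe, mem_sigma, mem_range] at hab
    obtain ⟨p, hp, h1, h2, -⟩ := H.exists_mem a b (m - a - b) (by omega)
    exact ⟨p, hp, by simp [h1, h2]⟩

lemma IsSimplex.mem_range (H : IsSimplex f g h P m) : ∀ p ∈ P, f p ∈ range (m + 1) :=
  fun p hp => Finset.mem_range.2 (by have := H.sum_eq p hp; omega)

lemma powersetCard_fiber_subset_coll (f : α → ℕ) (k : ℕ) (P : Finset α) (i : ℕ) :
    (fiber f P i).powersetCard k ⊆ coll f k P := by
  intro T hT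
  rw [mem_powersetCard] at hT
  exact mem_coll.2 ⟨fun p hp => (mem_fiber.1 (hT.1 hp)).1, hT.2, fun p hp q hq =>
    (mem_fiber.1 (hT.1 hp)).2.trans (mem_fiber.1 (hT.1 hq)).2.symm⟩

variable [DecidableEq α]

lemma mem_inter_of_card_eq_one {f g : α → ℕ} {i j : ℕ} {T U : Finset α}
    (hT : T ⊆ fiber f P i) (hU : U ⊆ fiber g P j) (hTU : #(T ∩ U) = 1) :
    ∃ p ∈ P, f p = i ∧ g p = j ∧ T ∩ U = {p} := by
  obtain ⟨p, hp⟩ := card_eq_one.1 hTU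
  have hp' : p ∈ T ∩ U := hp ▸ mem_singleton_self p
  rw [mem_inter] at hp'
  exact ⟨p, (mem_fiber.1 (hT hp'.1)).1, (mem_fiber.1 (hT hp'.1)).2, (mem_fiber.1 (hU hp'.2)).2, hp⟩

lemma inter_eq_singleton {f g : α → ℕ} (hfg : JointInj f g P) {T U : Finset α} {p : α}
    (hT : T ⊆ fiber f P (f p)) (hU : U ⊆ fiber g P (g p)) (hpP : p ∈ P) (hpT : p ∈ T)
    (hpU : p ∈ U) : T ∩ U = {p} := by
  ext q
  rw [mem_inter, mem_singleton]
  constructor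
  · rintro ⟨h1, h2⟩
    have h1 := mem_fiber.1 (hT h1)
    exact hfg q h1.1 p hpP h1.2 (mem_fiber.1 (hU h2)).2
  · rintro rfl
    exact ⟨hpT, hpU⟩

lemma card_union_three_eq_six_iff {f g h : α → ℕ} (hfg : JointInj f g P)
    (hfh : JointInj f h P) (hgh : JointInj g h P) {T U V : Finset α} (hT : T ∈ coll f 3 P)
    (hU : U ∈ coll g 3 P) (hV : V ∈ coll h 3 P) :
    #(T ∪ U ∪ V) = 6 ↔ #(T ∩ U) = 1 ∧ #(T ∩ V) = 1 ∧ #(U ∩ V) = 1 ∧ #(T ∩ U ∩ V) = 0 := by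
  have h1 := hfg.card_inter_le hT hU
  have h2 := hfh.card_inter_le hT hV
  have h3 := hgh.card_inter_le hU hV
  have h4 := card_union_three_add T U V
  rw [mem_coll] at hT hU hV
  omega

lemma IsSimplex.card_triangles_on_lines (H : IsSimplex f g h P m) (i j k : ℕ) :
    #(((fiber f P i).powersetCard 3 ×ˢ (fiber g P j).powersetCard 3 ×ˢ
        (fiber h P k).powersetCard 3).filter fun A => #(A.1 ∪ A.2.1 ∪ A.2.2) = 6) =
      if i + j ≤ m ∧ i + k ≤ m ∧ j + k ≤ m ∧ i + j + k ≠ m then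
        (m - 1 - i) * ((m - 1 - j) * (m - 1 - k)) else 0 := by
  have hfg : JointInj f g P := H.inj
  have hfh : JointInj f h P := JointInj.symm H.rotate.rotate.inj
  have hgh : JointInj g h P := H.rotate.inj
  split_ifs with hc
  · obtain ⟨u, hu, hu1, hu2, hu3⟩ := H.exists_mem i j (m - i - j) (by omega)
    obtain ⟨v, hv, hv1, hv2, hv3⟩ := H.exists_mem i (m - i - k) k (by omega)
    obtain ⟨w, hw, hw1, hw2, hw3⟩ := H.exists_mem (m - j - k) j k (by omega)
    have huv : u ≠ v := by rintro rfl; omega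
    have huw : u ≠ w := by rintro rfl; omega
    have hvw : v ≠ w := by rintro rfl; omega
    have key : ∀ (L : Finset α) (x y : α) (d : ℕ), x ≠ y → x ∈ L → y ∈ L → #L = m + 1 - d →
        #((L.powersetCard 3).filter fun T => {x, y} ⊆ T) = m - 1 - d := by
      intro L x y d hxy hx hy hL
      rw [card_filter_powersetCard_subset _ _ _ (by simp [insert_subset_iff, hx, hy])
        (by rw [card_pair hxy]; norm_num), card_pair hxy, hL]
      norm_num
      omega
    rw [← key _ u v i huv (mem_fiber.2 ⟨hu, hu1⟩) (mem_fiber.2 ⟨hv, hv1⟩) (H.card_fiber i),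
      ← key _ u w j huw (mem_fiber.2 ⟨hu, hu2⟩) (mem_fiber.2 ⟨hw, hw2⟩) (H.rotate.card_fiber j),
      ← key _ v w k hvw (mem_fiber.2 ⟨hv, hv3⟩) (mem_fiber.2 ⟨hw, hw3⟩)
        (H.rotate.rotate.card_fiber k), ← card_product, ← card_product, ← filter_product,
      ← filter_product]
    congr 1
    refine filter_congr ?_
    rintro ⟨T, U, V⟩ hA
    simp only [mem_product] at hA
    have hT := (mem_powersetCard.1 hA.1).1
    have hU := (mem_powersetCard.1 hA.2.1).1
    have hV := (mem_powersetCard.1 hA.2.2).1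
    rw [card_union_three_eq_six_iff hfg hfh hgh
      (powersetCard_fiber_subset_coll f 3 P i hA.1)
      (powersetCard_fiber_subset_coll g 3 P j hA.2.1)
      (powersetCard_fiber_subset_coll h 3 P k hA.2.2)]
    simp only [insert_subset_iff, singleton_subset_iff]
    constructor
    · rintro ⟨h1, h2, h3, -⟩
      obtain ⟨p, hp, hp1, hp2, hpe⟩ := mem_inter_of_card_eq_one hT hU h1
      obtain ⟨q, hq, hq1, hq2, hqe⟩ := mem_inter_of_card_eq_one hT hV h2
      obtain ⟨r, hr, hr1, hr2, hre⟩ := mem_inter_of_card_eq_one hU hV h3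
      obtain rfl := hfg p hp u hu (hp1.trans hu1.symm) (hp2.trans hu2.symm)
      obtain rfl := hfh q hq v hv (hq1.trans hv1.symm) (hq2.trans hv3.symm)
      obtain rfl := hgh r hr w hw (hr1.trans hw2.symm) (hr2.trans hw3.symm)
      have mp := mem_inter.1 (hpe ▸ mem_singleton_self p)
      have mq := mem_inter.1 (hqe ▸ mem_singleton_self q)
      have mr := mem_inter.1 (hre ▸ mem_singleton_self r)
      exact ⟨⟨mp.1, mq.1⟩, ⟨mp.2, mr.1⟩, mq.2, mr.2⟩
    · rintro ⟨⟨huT, hvT⟩, ⟨huU, hwU⟩, hvV, hwV⟩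
      have e1 : T ∩ U = {u} :=
        inter_eq_singleton hfg (by rwa [hu1]) (by rwa [hu2]) hu huT huU
      have e2 : T ∩ V = {v} :=
        inter_eq_singleton hfh (by rwa [hv1]) (by rwa [hv3]) hv hvT hvV
      have e3 : U ∩ V = {w} :=
        inter_eq_singleton hgh (by rwa [hw2]) (by rwa [hw3]) hw hwU hwV
      refine ⟨by simp [e1], by simp [e2], by simp [e3], ?_⟩
      rw [e1, card_eq_zero, singleton_inter_of_notMem]
      intro huV
      have hm : u ∈ T ∩ V := mem_inter.2 ⟨huT, huV⟩
      rw [e2, mem_singleton] at hm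
      exact huv hm
  · refine card_eq_zero.2 (filter_eq_empty_iff.2 ?_)
    rintro ⟨T, U, V⟩ hA h6
    simp only [mem_product] at hA
    have hT := (mem_powersetCard.1 hA.1).1
    have hU := (mem_powersetCard.1 hA.2.1).1
    have hV := (mem_powersetCard.1 hA.2.2).1
    rw [card_union_three_eq_six_iff hfg hfh hgh
      (powersetCard_fiber_subset_coll f 3 P i hA.1)
      (powersetCard_fiber_subset_coll g 3 P j hA.2.1)
      (powersetCard_fiber_subset_coll h 3 P k hA.2.2)] at h6
    obtain ⟨h1, h2, h3, h4⟩ := h6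
    obtain ⟨p, hp, hp1, hp2, hpe⟩ := mem_inter_of_card_eq_one hT hU h1
    obtain ⟨q, hq, hq1, hq2, hqe⟩ := mem_inter_of_card_eq_one hT hV h2
    obtain ⟨r, hr, hr1, hr2, hre⟩ := mem_inter_of_card_eq_one hU hV h3
    have sp := H.sum_eq p hp
    have sq := H.sum_eq q hq
    have sr := H.sum_eq r hr
    refine hc ⟨by omega, by omega, by omega, fun hs => ?_⟩
    obtain rfl := hfh p hp q hq (hp1.trans hq1.symm) (by omega)
    have mp := mem_inter.1 (hpe ▸ mem_singleton_self p)
    have mq := mem_inter.1 (hqe ▸ mem_singleton_self p)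
    rw [card_eq_zero] at h4
    exact notMem_empty p (h4 ▸ mem_inter.2 ⟨mem_inter.2 mp, mq.2⟩)

lemma IsSimplex.card_triangles (H : IsSimplex f g h P m) :
    #(triangles f g h P) = ∑ i ∈ range (m + 1), ∑ j ∈ range (m + 1), ∑ k ∈ range (m + 1),
      if i + j ≤ m ∧ i + k ≤ m ∧ j + k ≤ m ∧ i + j + k ≠ m then
        (m - 1 - i) * ((m - 1 - j) * (m - 1 - k)) else 0 := by
  simp only [← H.card_triangles_on_lines, card_filter, sum_product]
  rw [triangles, card_filter, sum_product, sum_coll (by norm_num) H.mem_range]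
  refine sum_congr rfl fun i _ => ?_
  symm
  rw [sum_congr rfl fun j _ => sum_comm, sum_comm]
  refine sum_congr rfl fun T _ => ?_
  rw [sum_product, sum_coll (by norm_num) H.rotate.mem_range]
  refine sum_congr rfl fun j _ => ?_
  rw [sum_comm]
  refine sum_congr rfl fun U _ => ?_
  rw [sum_coll (by norm_num) H.rotate.rotate.mem_range]

end Simplex

section Choose

lemma cast_choose_succ (n k : ℕ) :
    ((n.choose (k + 1) : ℕ) : ℚ) = n.choose k * (n - k) / (k + 1) := by
  rw [eq_div_iff (by positivity)]
  have h := Nat.choose_succ_right_eq n k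
  rcases le_or_gt k n with hk | hk
  · rw [← Nat.cast_sub hk]
    exact_mod_cast h
  · simp [Nat.choose_eq_zero_of_lt hk, Nat.choose_eq_zero_of_lt (hk.trans (Nat.lt_succ_self k))]

lemma cast_choose_three (n : ℕ) : (n.choose 3 : ℚ) = n * (n - 1) * (n - 2) / 6 := by
  rw [cast_choose_succ, Nat.cast_choose_two]
  push_cast
  ring

lemma cast_choose_four (n : ℕ) : (n.choose 4 : ℚ) = n * (n - 1) * (n - 2) * (n - 3) / 24 := by
  rw [cast_choose_succ, cast_choose_three]
  push_cast
  ring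

lemma cast_choose_five (n : ℕ) :
    (n.choose 5 : ℚ) = n * (n - 1) * (n - 2) * (n - 3) * (n - 4) / 120 := by
  rw [cast_choose_succ, cast_choose_four]
  push_cast
  ring

lemma cast_choose_six (n : ℕ) :
    (n.choose 6 : ℚ) = n * (n - 1) * (n - 2) * (n - 3) * (n - 4) * (n - 5) / 720 := by
  rw [cast_choose_succ, cast_choose_five]
  push_cast
  ring

lemma cast_choose_seven (n : ℕ) :
    (n.choose 7 : ℚ) = n * (n - 1) * (n - 2) * (n - 3) * (n - 4) * (n - 5) * (n - 6) / 5040 := by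
  rw [cast_choose_succ, cast_choose_six]
  push_cast
  ring

lemma sum_range_choose_sub (n : ℕ) {k : ℕ} (hk : 1 ≤ k) :
    ∑ i ∈ range n, (n - i).choose k = (n + 1).choose (k + 1) := by
  induction n with
  | zero => simp [Nat.choose_eq_zero_of_lt (show 1 < k + 1 by omega)]
  | succ n ih =>
    rw [sum_range_succ', Nat.choose_succ_succ (n + 1) k, ← ih]
    simp [Nat.add_sub_add_right, add_comm]

lemma sum_range_choose_three_sub_sq (n : ℕ) :
    ((∑ i ∈ range n, (n - i).choose 3 ^ 2 : ℕ) : ℚ) =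
      (10 * n ^ 7 - 35 * n ^ 6 + 7 * n ^ 5 + 70 * n ^ 4 - 35 * n ^ 3 - 35 * n ^ 2 + 18 * n)
        / 2520 := by
  induction n with
  | zero => simp
  | succ n ih =>
    rw [sum_range_succ']
    simp only [Nat.add_sub_add_right, Nat.sub_zero]
    rw [Nat.cast_add, ih, Nat.cast_pow, cast_choose_three]
    push_cast
    ring

end Choose

section TriangularSums

lemma sum_range_sum_range_sub {M : Type*} [AddCommMonoid M] (m : ℕ) (F : ℕ → ℕ → M) :
    ∑ a ∈ range (m + 1), ∑ b ∈ range (m + 1 - a), F a b =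
      ∑ p ∈ range (m + 1), ∑ b ∈ range (p + 1), F (m - p) b := by
  rw [← sum_range_reflect]
  refine sum_congr rfl fun p hp => ?_
  rw [mem_range] at hp
  rw [show m + 1 - 1 - p = m - p by omega, show m + 1 - (m - p) = p + 1 by omega]

lemma sum_range_choose_two_sub (q : ℕ) (t : ℚ) :
    ∑ b ∈ range q, (t - b) * (t - b - 1) / 2 =
      (q ^ 3 - 3 * q ^ 2 * t + 3 * q * t ^ 2 - q) / 6 := by
  induction q with
  | zero => simp
  | succ q ih => rw [sum_range_succ, ih]; push_cast; ring

lemma sum_range_choose_three_sub (q : ℕ) (t : ℚ) :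
    ∑ b ∈ range q, (t - b) * (t - b - 1) * (t - b - 2) / 6 =
      (-q ^ 4 + 4 * q ^ 3 * t - 2 * q ^ 3 - 6 * q ^ 2 * t ^ 2 + 6 * q ^ 2 * t + q ^ 2
        + 4 * q * t ^ 3 - 6 * q * t ^ 2 - 2 * q * t + 2 * q) / 24 := by
  induction q with
  | zero => simp
  | succ q ih => rw [sum_range_succ, ih]; push_cast; ring

lemma sum_choose_two_mul_choose_two (m : ℕ) :
    ((∑ a ∈ range (m + 1), ∑ b ∈ range (m + 1 - a), (m - a).choose 2 * (m - b).choose 2 : ℕ) : ℚ) =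
      (19 * m ^ 6 + 9 * m ^ 5 - 65 * m ^ 4 + 15 * m ^ 3 + 46 * m ^ 2 - 24 * m) / 720 := by
  have h : ∀ (r : ℕ) (t : ℚ), ∑ p ∈ range r, (p * (p - 1) / 2 : ℚ) *
      ((((p + 1 : ℕ) : ℚ) ^ 3 - 3 * (p + 1 : ℕ) ^ 2 * t + 3 * (p + 1 : ℕ) * t ^ 2 - (p + 1 : ℕ)) / 6)
      = (10 * r ^ 6 - 36 * r ^ 5 * t - 6 * r ^ 5 + 45 * r ^ 4 * t ^ 2 + 45 * r ^ 4 * t - 50 * r ^ 4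
        - 90 * r ^ 3 * t ^ 2 + 90 * r ^ 3 * t + 30 * r ^ 3 - 45 * r ^ 2 * t ^ 2 - 45 * r ^ 2 * t
        + 40 * r ^ 2 + 90 * r * t ^ 2 - 54 * r * t - 24 * r) / 720 := by
    intro r t
    induction r with
    | zero => simp
    | succ r ih => rw [sum_range_succ, ih]; push_cast; ring
  rw [sum_range_sum_range_sub]
  push_cast
  rw [sum_congr rfl (g := fun p : ℕ => (p * (p - 1) / 2 : ℚ) * ((((p + 1 : ℕ) : ℚ) ^ 3
      - 3 * (p + 1 : ℕ) ^ 2 * (m : ℚ) + 3 * (p + 1 : ℕ) * (m : ℚ) ^ 2 - (p + 1 : ℕ)) / 6)), h]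
  · push_cast; ring
  intro p hp
  rw [mem_range] at hp
  rw [← mul_sum, Nat.sub_sub_self (by omega), Nat.cast_choose_two, ← sum_range_choose_two_sub]
  congr 1
  refine sum_congr rfl fun b hb => ?_
  rw [mem_range] at hb
  rw [Nat.cast_choose_two, Nat.cast_sub (by omega)]

lemma sum_choose_two_mul_choose_three (m : ℕ) :
    ((∑ a ∈ range (m + 1), ∑ b ∈ range (m + 1 - a), (m - a).choose 2 * (m - b).choose 3 : ℕ) : ℚ) =
      (17 * m ^ 7 - 28 * m ^ 6 - 70 * m ^ 5 + 140 * m ^ 4 - 7 * m ^ 3 - 112 * m ^ 2 + 60 * m)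
        / 2520 := by
  have h : ∀ (r : ℕ) (t : ℚ), ∑ p ∈ range r, (p * (p - 1) / 2 : ℚ) *
      ((-((p + 1 : ℕ) : ℚ) ^ 4 + 4 * (p + 1 : ℕ) ^ 3 * t - 2 * (p + 1 : ℕ) ^ 3
        - 6 * (p + 1 : ℕ) ^ 2 * t ^ 2 + 6 * (p + 1 : ℕ) ^ 2 * t + (p + 1 : ℕ) ^ 2
        + 4 * (p + 1 : ℕ) * t ^ 3 - 6 * (p + 1 : ℕ) * t ^ 2 - 2 * (p + 1 : ℕ) * t
        + 2 * (p + 1 : ℕ)) / 24)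
      = (-15 * r ^ 7 + 70 * r ^ 6 * t - 35 * r ^ 6 - 126 * r ^ 5 * t ^ 2 + 84 * r ^ 5 * t
        + 105 * r ^ 5 + 105 * r ^ 4 * t ^ 3 - 455 * r ^ 4 * t + 175 * r ^ 4 - 210 * r ^ 3 * t ^ 3
        + 630 * r ^ 3 * t ^ 2 - 210 * r ^ 3 * t - 210 * r ^ 3 - 105 * r ^ 2 * t ^ 3
        + 385 * r ^ 2 * t - 140 * r ^ 2 + 210 * r * t ^ 3 - 504 * r * t ^ 2 + 126 * r * t
        + 120 * r) / 5040 := by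
    intro r t
    induction r with
    | zero => simp
    | succ r ih => rw [sum_range_succ, ih]; push_cast; ring
  rw [sum_range_sum_range_sub]
  push_cast
  rw [sum_congr rfl (g := fun p : ℕ => (p * (p - 1) / 2 : ℚ) *
      ((-((p + 1 : ℕ) : ℚ) ^ 4 + 4 * (p + 1 : ℕ) ^ 3 * (m : ℚ) - 2 * (p + 1 : ℕ) ^ 3
        - 6 * (p + 1 : ℕ) ^ 2 * (m : ℚ) ^ 2 + 6 * (p + 1 : ℕ) ^ 2 * (m : ℚ) + (p + 1 : ℕ) ^ 2
        + 4 * (p + 1 : ℕ) * (m : ℚ) ^ 3 - 6 * (p + 1 : ℕ) * (m : ℚ) ^ 2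
        - 2 * (p + 1 : ℕ) * (m : ℚ) + 2 * (p + 1 : ℕ)) / 24)), h]
  · push_cast; ring
  intro p hp
  rw [mem_range] at hp
  rw [← mul_sum, Nat.sub_sub_self (by omega), Nat.cast_choose_two, ← sum_range_choose_three_sub]
  congr 1
  refine sum_congr rfl fun b hb => ?_
  rw [mem_range] at hb
  rw [cast_choose_three, Nat.cast_sub (by omega)]

lemma sum_choose_three_mul_choose_two (m : ℕ) :
    ∑ a ∈ range (m + 1), ∑ b ∈ range (m + 1 - a), (m - a).choose 3 * (m - b).choose 2 =
      ∑ a ∈ range (m + 1), ∑ b ∈ range (m + 1 - a), (m - a).choose 2 * (m - b).choose 3 := by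
  rw [sum_comm' (t' := range (m + 1)) (s' := fun b => range (m + 1 - b))
    (by intro x y; simp only [mem_range]; omega)]
  simp only [mul_comm]

lemma sum_ite_add_lt {M : Type*} [AddCommMonoid M] {s B : ℕ} (hB : s ≤ B) (F : ℕ → ℕ → M) :
    ∑ i ∈ range B, ∑ j ∈ range B, (if i + j < s then F i j else 0) =
      ∑ i ∈ range s, ∑ j ∈ range (s - i), F i j := by
  rw [← sum_subset (range_mono hB)]
  · refine sum_congr rfl fun i hi => ?_
    rw [← sum_filter]
    congr 1
    ext j
    simp only [mem_filter, mem_range]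
    omega
  · intro i _ hi
    rw [mem_range] at hi
    exact sum_eq_zero fun j _ => if_neg (by omega)

lemma sum_ite_lt {M : Type*} [AddCommMonoid M] {s B : ℕ} (hB : s ≤ B) (F : ℕ → M) :
    ∑ i ∈ range B, (if i < s then F i else 0) = ∑ i ∈ range s, F i := by
  rw [← sum_filter]
  congr 1
  ext i
  simp only [mem_filter, mem_range]
  omega

lemma sum_range_sub (s : ℕ) (t : ℚ) :
    ∑ i ∈ range s, (t - i) = s * t - s * (s - 1) / 2 := by
  induction s with
  | zero => simp
  | succ s ih => rw [sum_range_succ, ih]; push_cast; ring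

lemma sum_triangle_mul (s : ℕ) (t : ℚ) :
    ∑ i ∈ range s, ∑ j ∈ range (s - i), (t - i) * (t - j) =
      (s ^ 4 - 8 * s ^ 3 * t - 2 * s ^ 3 + 12 * s ^ 2 * t ^ 2 - s ^ 2 + 12 * s * t ^ 2
        + 8 * s * t + 2 * s) / 24 := by
  have h : ∀ (r : ℕ) (u : ℚ), ∑ i ∈ range r, (t - i) * ((u - i) * t - (u - i) * (u - i - 1) / 2) =
      r * t ^ 2 * u - (r * (r - 1) / 2) * (t ^ 2 + t * u)
        + (r * (r - 1) * (2 * r - 1) / 6) * t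
        - ∑ i ∈ range r, (t - i) * (u - i) * (u - i - 1) / 2 := by
    intro r u
    induction r with
    | zero => simp
    | succ r ih => rw [sum_range_succ, ih, sum_range_succ]; push_cast; ring
  have h' : ∀ (r : ℕ) (u : ℚ), ∑ i ∈ range r, (t - i) * (u - i) * (u - i - 1) / 2 =
      r * t * u * (u - 1) / 2 - (r * (r - 1) / 4) * (u * (u - 1) + t * (2 * u - 1))
        + (r * (r - 1) * (2 * r - 1) / 12) * (t + 2 * u - 1) - r ^ 2 * (r - 1) ^ 2 / 8 := by
    intro r u
    induction r with
    | zero => simp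
    | succ r ih => rw [sum_range_succ, ih]; push_cast; ring
  rw [sum_congr rfl (g := fun i : ℕ => (t - i) *
    (((s : ℚ) - i) * t - ((s : ℚ) - i) * ((s : ℚ) - i - 1) / 2)), h, h']
  · ring
  intro i hi
  rw [mem_range] at hi
  rw [← mul_sum, sum_range_sub, Nat.cast_sub hi.le]

lemma sum_range_mul_add (q : ℕ) (t c : ℚ) :
    ∑ j ∈ range q, (t - j) * (j + c) =
      (-2 * q ^ 3 + 3 * q ^ 2 * t - 3 * q ^ 2 * c + 3 * q ^ 2 + 6 * q * t * c - 3 * q * t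
        + 3 * q * c - q) / 6 := by
  induction q with
  | zero => simp
  | succ q ih => rw [sum_range_succ, ih]; push_cast; ring

lemma sum_concurrent (m : ℕ) :
    ∑ i ∈ range (m + 1), ∑ j ∈ range (m + 1 - i),
      ((m : ℚ) - 1 - i) * (((m : ℚ) - 1 - j) * (i + j - 1)) =
      (14 * m ^ 5 - 45 * m ^ 4 - 100 * m ^ 3 + 165 * m ^ 2 + 86 * m - 120) / 120 := by
  have h : ∀ (r : ℕ) (t : ℚ), ∑ p ∈ range r, (p - 1 : ℚ) *
      ((-2 * (p + 1 : ℕ) ^ 3 + 3 * (p + 1 : ℕ) ^ 2 * (t - 1) - 3 * (p + 1 : ℕ) ^ 2 * (t - p - 1)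
        + 3 * (p + 1 : ℕ) ^ 2 + 6 * (p + 1 : ℕ) * (t - 1) * (t - p - 1) - 3 * (p + 1 : ℕ) * (t - 1)
        + 3 * (p + 1 : ℕ) * (t - p - 1) - (p + 1 : ℕ)) / 6) =
      (4 * r ^ 5 - 30 * r ^ 4 * t + 15 * r ^ 4 + 40 * r ^ 3 * t ^ 2 - 20 * r ^ 3 * t - 10 * r ^ 3
        - 60 * r ^ 2 * t ^ 2 + 150 * r ^ 2 * t - 75 * r ^ 2 - 100 * r * t ^ 2 + 140 * r * t
        - 54 * r) / 120 := by
    intro r t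
    induction r with
    | zero => simp
    | succ r ih => rw [sum_range_succ, ih]; push_cast; ring
  rw [sum_range_sum_range_sub]
  trans ((4 * (m + 1 : ℕ) ^ 5 - 30 * (m + 1 : ℕ) ^ 4 * (m : ℚ) + 15 * (m + 1 : ℕ) ^ 4
    + 40 * (m + 1 : ℕ) ^ 3 * (m : ℚ) ^ 2 - 20 * (m + 1 : ℕ) ^ 3 * (m : ℚ) - 10 * (m + 1 : ℕ) ^ 3
    - 60 * (m + 1 : ℕ) ^ 2 * (m : ℚ) ^ 2 + 150 * (m + 1 : ℕ) ^ 2 * (m : ℚ) - 75 * (m + 1 : ℕ) ^ 2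
    - 100 * (m + 1 : ℕ) * (m : ℚ) ^ 2 + 140 * (m + 1 : ℕ) * (m : ℚ) - 54 * (m + 1 : ℕ)) / 120)
  · rw [← h]
    refine sum_congr rfl fun p hp => ?_
    rw [mem_range] at hp
    rw [← mul_sum, ← sum_range_mul_add, Nat.cast_sub (by omega)]
    congr 1
    · ring
    · exact sum_congr rfl fun j _ => by ring
  · push_cast; ring

/-- The sum over triples of pairwise sum less than `s`; it is only a quasi-polynomial in `s`. -/
lemma sum_pairwise_add_lt (s : ℕ) : ∀ (t : ℚ) (B : ℕ), s ≤ B →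
    ∑ i ∈ range B, ∑ j ∈ range B, ∑ k ∈ range B,
      (if i + j < s ∧ i + k < s ∧ j + k < s then (t - i) * ((t - j) * (t - k)) else 0) =
    (-6 * s ^ 6 + 72 * s ^ 5 * t + 18 * s ^ 5 - 280 * s ^ 4 * t ^ 2 - 100 * s ^ 4 * t - 10 * s ^ 4
      + 320 * s ^ 3 * t ^ 3 - 80 * s ^ 3 * t ^ 2 - 80 * s ^ 3 * t - 10 * s ^ 3
      + 480 * s ^ 2 * t ^ 3 + 160 * s ^ 2 * t ^ 2 - 20 * s ^ 2 * t - 9 * s ^ 2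
      + 320 * s * t ^ 3 + 200 * s * t ^ 2 + 68 * s * t + 17 * s + 80 * t ^ 3 + 60 * t ^ 2
      + 30 * t + 5) / 1280 +
    (-1) ^ s * (2 * s ^ 3 - 12 * s ^ 2 * t - 3 * s ^ 2 + 24 * s * t ^ 2 + 12 * s * t + 3 * s
      - 16 * t ^ 3 - 12 * t ^ 2 - 6 * t - 1) / 256 := by
  induction s using Nat.twoStepInduction with
  | zero =>
    intro t B _
    simp
    ring
  | one =>
    intro t B hB
    obtain ⟨B, rfl⟩ : ∃ C, B = C + 1 := ⟨B - 1, by omega⟩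
    simp [sum_range_succ']
    ring
  | more s ih _ =>
    intro t B hB
    obtain ⟨B, rfl⟩ : ∃ C, B = C + 1 := ⟨B - 1, by omega⟩
    have e3 := ih (t - 1) B (by omega)
    have e2 : ∑ i ∈ range B, ∑ j ∈ range B,
        (if i + j < s then (t - 1 - i) * (t - 1 - j) else 0) = _ :=
      (sum_ite_add_lt (by omega) _).trans (sum_triangle_mul s (t - 1))
    have e1 : ∑ i ∈ range B, (if i < s + 1 then t - 1 - i else 0) = _ :=
      (sum_ite_lt (by omega) _).trans (sum_range_sub (s + 1) (t - 1))
    have c3 : ∀ i j k : ℕ, (if i + 1 + (j + 1) < s + 2 ∧ i + 1 + (k + 1) < s + 2 ∧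
        j + 1 + (k + 1) < s + 2 then (t - (i + 1 : ℕ)) * ((t - (j + 1 : ℕ)) * (t - (k + 1 : ℕ)))
        else 0) = if i + j < s ∧ i + k < s ∧ j + k < s then
          (t - 1 - i) * ((t - 1 - j) * (t - 1 - k)) else 0 := by
      intro i j k
      refine if_congr (by omega) ?_ rfl
      push_cast; ring
    have c2 : ∀ i j : ℕ, (if i + 1 + (j + 1) < s + 2 ∧ i + 1 + 0 < s + 2 ∧
        j + 1 + 0 < s + 2 then (t - (i + 1 : ℕ)) * ((t - (j + 1 : ℕ)) * (t - (0 : ℕ))) else 0) =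
        t * if i + j < s then (t - 1 - i) * (t - 1 - j) else 0 := by
      intro i j
      rw [mul_ite, mul_zero]
      refine if_congr (by omega) ?_ rfl
      push_cast; ring
    have c2' : ∀ i j : ℕ, (if i + 1 + 0 < s + 2 ∧ i + 1 + (j + 1) < s + 2 ∧
        0 + (j + 1) < s + 2 then (t - (i + 1 : ℕ)) * ((t - (0 : ℕ)) * (t - (j + 1 : ℕ))) else 0) =
        t * if i + j < s then (t - 1 - i) * (t - 1 - j) else 0 := by
      intro i j
      rw [mul_ite, mul_zero]
      refine if_congr (by omega) ?_ rfl
      push_cast; ring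
    have c2'' : ∀ i j : ℕ, (if 0 + (i + 1) < s + 2 ∧ 0 + (j + 1) < s + 2 ∧
        i + 1 + (j + 1) < s + 2 then (t - (0 : ℕ)) * ((t - (i + 1 : ℕ)) * (t - (j + 1 : ℕ)))
        else 0) = t * if i + j < s then (t - 1 - i) * (t - 1 - j) else 0 := by
      intro i j
      rw [mul_ite, mul_zero]
      refine if_congr (by omega) ?_ rfl
      push_cast; ring
    have c1 : ∀ i : ℕ, (if i + 1 + 0 < s + 2 ∧ i + 1 + 0 < s + 2 ∧ 0 + 0 < s + 2 then
        (t - (i + 1 : ℕ)) * ((t - (0 : ℕ)) * (t - (0 : ℕ))) else 0) =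
        t ^ 2 * if i < s + 1 then t - 1 - i else 0 := by
      intro i
      rw [mul_ite, mul_zero]
      refine if_congr (by omega) ?_ rfl
      push_cast; ring
    have c1' : ∀ i : ℕ, (if 0 + (i + 1) < s + 2 ∧ 0 + 0 < s + 2 ∧ i + 1 + 0 < s + 2 then
        (t - (0 : ℕ)) * ((t - (i + 1 : ℕ)) * (t - (0 : ℕ))) else 0) =
        t ^ 2 * if i < s + 1 then t - 1 - i else 0 := by
      intro i
      rw [mul_ite, mul_zero]
      refine if_congr (by omega) ?_ rfl
      push_cast; ring
    have c1'' : ∀ i : ℕ, (if 0 + 0 < s + 2 ∧ 0 + (i + 1) < s + 2 ∧ 0 + (i + 1) < s + 2 then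
        (t - (0 : ℕ)) * ((t - (0 : ℕ)) * (t - (i + 1 : ℕ))) else 0) =
        t ^ 2 * if i < s + 1 then t - 1 - i else 0 := by
      intro i
      rw [mul_ite, mul_zero]
      refine if_congr (by omega) ?_ rfl
      push_cast; ring
    have c0 : (if 0 + 0 < s + 2 ∧ 0 + 0 < s + 2 ∧ 0 + 0 < s + 2 then
        (t - (0 : ℕ)) * ((t - (0 : ℕ)) * (t - (0 : ℕ))) else 0) = t ^ 3 := by
      rw [if_pos (by omega)]
      push_cast; ring
    simp only [sum_range_succ', sum_add_distrib, c3, c2, c2', c2'', c1, c1', c1'', c0, ← mul_sum,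
      e3, e2, e1]
    push_cast
    ring

lemma sum_triangles (m : ℕ) :
    ((∑ i ∈ range (m + 1), ∑ j ∈ range (m + 1), ∑ k ∈ range (m + 1),
      (if i + j ≤ m ∧ i + k ≤ m ∧ j + k ≤ m ∧ i + j + k ≠ m then
        (m - 1 - i) * ((m - 1 - j) * (m - 1 - k)) else 0) : ℕ) : ℚ) =
    ∑ i ∈ range (m + 1), ∑ j ∈ range (m + 1), ∑ k ∈ range (m + 1),
      (if i + j < m + 1 ∧ i + k < m + 1 ∧ j + k < m + 1 then
        ((m : ℚ) - 1 - i) * (((m : ℚ) - 1 - j) * ((m : ℚ) - 1 - k)) else 0) -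
    ∑ i ∈ range (m + 1), ∑ j ∈ range (m + 1 - i),
      ((m : ℚ) - 1 - i) * (((m : ℚ) - 1 - j) * (i + j - 1)) := by
  rw [← sum_ite_add_lt le_rfl, ← sum_sub_distrib]
  push_cast
  refine sum_congr rfl fun i hi => ?_
  rw [← sum_sub_distrib]
  refine sum_congr rfl fun j hj => ?_
  have hk : (if i + j < m + 1 then ((m : ℚ) - 1 - i) * (((m : ℚ) - 1 - j) * (i + j - 1)) else 0) =
      ∑ k ∈ range (m + 1), if i + j + k = m then
        ((m : ℚ) - 1 - i) * (((m : ℚ) - 1 - j) * (m - 1 - k)) else 0 := by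
    split_ifs with h
    · rw [sum_eq_single (m - i - j)]
      · rw [if_pos (by omega), Nat.sub_sub, Nat.cast_sub (by omega)]
        push_cast
        ring
      · intro k _ hk
        exact if_neg (by omega)
      · intro hk
        rw [mem_range] at hk
        omega
    · exact (sum_eq_zero fun k _ => if_neg (by omega)).symm
  rw [hk, ← sum_sub_distrib]
  refine sum_congr rfl fun k hk => ?_
  by_cases h1 : i + j + k = m
  · rw [if_neg (by omega), if_pos (by omega), if_pos h1, sub_self]
  · rw [if_neg h1, sub_zero]
    by_cases h2 : i + j < m + 1 ∧ i + k < m + 1 ∧ j + k < m + 1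
    · have e : ∀ x, x + 1 ≤ m → ((m - 1 - x : ℕ) : ℚ) = m - 1 - x := fun x hx => by
        rw [Nat.cast_sub (by omega), Nat.cast_sub (by omega), Nat.cast_one]
      rw [if_pos h2, if_pos (by omega), e i (by omega), e j (by omega), e k (by omega)]
    · rw [if_neg h2, if_neg (by omega)]

end TriangularSums

section Counting

variable {α : Type*} {f g h : α → ℕ} {P : Finset α} {m : ℕ}

lemma IsSimplex.card_eq (H : IsSimplex f g h P m) : (#P : ℚ) = (m + 1) * (m + 2) / 2 := by
  rw [card_eq_sum_card_fiberwise H.mem_range]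
  change ((∑ i ∈ range (m + 1), #(fiber f P i) : ℕ) : ℚ) = _
  simp only [H.card_fiber]
  rw [sum_congr rfl fun i _ => (Nat.choose_one_right _).symm, sum_range_choose_sub _ le_rfl,
    Nat.cast_choose_two]
  push_cast
  ring

lemma IsSimplex.six_le_card (H : IsSimplex f g h P m) (hm : 2 ≤ m) : 6 ≤ #P := by
  have h2 : (2 : ℚ) ≤ m := by exact_mod_cast hm
  have : (6 : ℚ) ≤ #P := by
    rw [H.card_eq]
    nlinarith
  exact_mod_cast this

lemma good_iff (f : α → ℕ) (S : Finset α) :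
    Good f S ↔ ∀ p ∈ S, ∀ q ∈ S, ∀ r ∈ S, p ≠ q → p ≠ r → q ≠ r → ¬(f p = f q ∧ f q = f r) := by
  constructor
  · rintro hS p hp q hq r hr hpq hpr hqr ⟨h1, h2⟩
    exact (two_lt_card_iff.2 ⟨p, q, r, mem_fiber.2 ⟨hp, rfl⟩, mem_fiber.2 ⟨hq, h1.symm⟩,
      mem_fiber.2 ⟨hr, (h1.trans h2).symm⟩, hpq, hpr, hqr⟩).not_ge (hS (f p))
  · intro hS i
    by_contra! hi
    obtain ⟨p, q, r, hp, hq, hr, hpq, hpr, hqr⟩ := two_lt_card_iff.1 hi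
    rw [mem_fiber] at hp hq hr
    exact hS p hp.1 q hq.1 r hr.1 hpq hpr hqr ⟨hp.2.trans hq.2.symm, hq.2.trans hr.2.symm⟩

variable [DecidableEq α]

lemma IsSimplex.card_coll (H : IsSimplex f g h P m) {k : ℕ} (hk : 1 ≤ k) :
    #(coll f k P) = (m + 2).choose (k + 1) := by
  rw [_root_.card_coll hk H.mem_range, ← sum_range_choose_sub _ hk]
  simp only [H.card_fiber]

lemma IsSimplex.card_collPairs (H : IsSimplex f g h P m) :
    (#(collPairs f P) : ℚ) = ((m + 2).choose 4 : ℚ) ^ 2 -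
      (10 * (m + 1 : ℕ) ^ 7 - 35 * (m + 1 : ℕ) ^ 6 + 7 * (m + 1 : ℕ) ^ 5 + 70 * (m + 1 : ℕ) ^ 4
        - 35 * (m + 1 : ℕ) ^ 3 - 35 * (m + 1 : ℕ) ^ 2 + 18 * (m + 1 : ℕ)) / 2520 := by
  have e := _root_.card_collPairs H.mem_range
  simp only [H.card_fiber, H.card_coll (show 1 ≤ 3 by norm_num)] at e
  rw [← sum_range_choose_three_sub_sq, eq_sub_iff_add_eq]
  exact_mod_cast e

lemma IsSimplex.crossings_eq (H : IsSimplex f g h P m) {k l : ℕ} (hk : 1 ≤ k) (hl : 1 ≤ l) :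
    crossings f g k l P = ∑ a ∈ range (m + 1), ∑ b ∈ range (m + 1 - a),
      (m - a).choose (k - 1) * (m - b).choose (l - 1) := by
  rw [_root_.crossings_eq f g hk hl,
    ← H.sum_comp fun a b => (m - a).choose (k - 1) * (m - b).choose (l - 1)]
  refine sum_congr rfl fun p _ => ?_
  rw [H.card_fiber, H.rotate.card_fiber, show m + 1 - f p - 1 = m - f p by omega,
    show m + 1 - g p - 1 = m - g p by omega]

lemma IsSimplex.sum_defect (H : IsSimplex f g h P m) (hm : 2 ≤ m) :
    ∑ S ∈ P.powersetCard 6, defect f S =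
      -((m + 2).choose 4 * ((#P - 3) * (#P - 4) * (#P - 5) / 6) : ℚ)
        + 3 * ((m + 2).choose 5 * ((#P - 4) * (#P - 5) / 2))
        - 6 * ((m + 2).choose 6 * (#P - 5)) + 10 * (m + 2).choose 7
        + (((m + 2).choose 4 : ℚ) ^ 2 - (10 * (m + 1 : ℕ) ^ 7 - 35 * (m + 1 : ℕ) ^ 6
          + 7 * (m + 1 : ℕ) ^ 5 + 70 * (m + 1 : ℕ) ^ 4 - 35 * (m + 1 : ℕ) ^ 3
          - 35 * (m + 1 : ℕ) ^ 2 + 18 * (m + 1 : ℕ)) / 2520) / 2 := by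
  have hP := H.six_le_card hm
  rw [_root_.sum_defect, H.card_collPairs, H.card_coll (by norm_num), H.card_coll (by norm_num),
    H.card_coll (by norm_num), H.card_coll (by norm_num), cast_choose_three, Nat.cast_choose_two,
    Nat.cast_sub (by omega), Nat.cast_sub (by omega), Nat.cast_sub (by omega)]
  push_cast
  ring

lemma IsSimplex.sum_defect_mul_defect (H : IsSimplex f g h P m) (hm : 2 ≤ m) :
    ∑ S ∈ P.powersetCard 6, defect f S * defect g S = ((m + 2).choose 4 : ℚ) ^ 2
      + (#P - 6) * ((19 * m ^ 6 + 9 * m ^ 5 - 65 * m ^ 4 + 15 * m ^ 3 + 46 * m ^ 2 - 24 * m) / 720)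
      - 6 * ((17 * m ^ 7 - 28 * m ^ 6 - 70 * m ^ 5 + 140 * m ^ 4 - 7 * m ^ 3 - 112 * m ^ 2
        + 60 * m) / 2520) := by
  rw [_root_.sum_defect_mul_defect H.inj (H.six_le_card hm), H.card_coll (by norm_num),
    H.rotate.card_coll (by norm_num), H.crossings_eq (by norm_num) (by norm_num),
    H.crossings_eq (by norm_num) (by norm_num), H.crossings_eq (by norm_num) (by norm_num)]
  norm_num only [sum_choose_three_mul_choose_two]
  rw [sum_choose_two_mul_choose_two, sum_choose_two_mul_choose_three]
  ring

open Classical in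
lemma IsSimplex.card_good (H : IsSimplex f g h P m) (hm : 2 ≤ m) :
    (#((P.powersetCard 6).filter fun S => Good f S ∧ Good g S ∧ Good h S) : ℚ) =
      (1 / 256) * (-1) ^ (m + 1) * (2 * (m + 1 : ℚ) - 7) *
        ((m + 1 : ℚ) ^ 2 - 7 * (m + 1 : ℚ) + 13) +
      (1 / 322560) * (7 * (m + 1 : ℚ) ^ 12 + 42 * (m + 1 : ℚ) ^ 11 - 945 * (m + 1 : ℚ) ^ 10 +
        1274 * (m + 1 : ℚ) ^ 9 + 26089 * (m + 1 : ℚ) ^ 8 - 128810 * (m + 1 : ℚ) ^ 7 +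
        175693 * (m + 1 : ℚ) ^ 6 + 205366 * (m + 1 : ℚ) ^ 5 - 810796 * (m + 1 : ℚ) ^ 4 +
        601328 * (m + 1 : ℚ) ^ 3 + 354172 * (m + 1 : ℚ) ^ 2 - 582180 * (m + 1 : ℚ) + 114660) := by
  rw [_root_.card_good H.inj (JointInj.symm H.rotate.rotate.inj) H.rotate.inj,
    H.sum_defect hm, H.rotate.sum_defect hm, H.rotate.rotate.sum_defect hm,
    H.sum_defect_mul_defect hm, H.rotate.sum_defect_mul_defect hm,
    H.rotate.rotate.sum_defect_mul_defect hm, H.card_triangles, sum_triangles,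
    sum_pairwise_add_lt (m + 1) (m - 1) (m + 1) le_rfl, sum_concurrent]
  simp only [cast_choose_four, cast_choose_five, cast_choose_six, cast_choose_seven, H.card_eq]
  push_cast
  ring

end Counting

/-- The points of the triangular grid `T_n`. -/
def triangularGrid (n : ℕ) : Finset (ℕ × ℕ) :=
  (range (n + 1) ×ˢ range (n + 1)).filter fun p => 1 ≤ p.2 ∧ p.2 ≤ p.1

lemma mem_triangularGrid {n : ℕ} {p : ℕ × ℕ} :
    p ∈ triangularGrid n ↔ 1 ≤ p.2 ∧ p.2 ≤ p.1 ∧ p.1 ≤ n := by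
  simp only [triangularGrid, mem_filter, mem_product, mem_range]
  omega

lemma isSimplex_triangularGrid (m : ℕ) :
    IsSimplex (fun p : ℕ × ℕ => m + 1 - p.1) (fun p => p.2 - 1) (fun p => p.1 - p.2)
      (triangularGrid (m + 1)) m where
  sum_eq p hp := by
    rw [mem_triangularGrid] at hp
    omega
  exists_mem a b c habc :=
    ⟨(b + c + 1, b + 1), mem_triangularGrid.2 (by dsimp only; omega), by dsimp only; omega⟩
  inj p hp q hq h1 h2 := by
    rw [mem_triangularGrid] at hp hq
    ext <;> omega

open Classical in
lemma a194478_eq_card (m : ℕ) :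
    a194478 (m + 1) = #(((triangularGrid (m + 1)).powersetCard 6).filter fun S =>
      Good (fun p => m + 1 - p.1) S ∧ Good (fun p => p.2 - 1) S ∧
        Good (fun p => p.1 - p.2) S) := by
  refine Nat.subtype_card _ fun S => ?_
  simp only [mem_filter, mem_powersetCard, good_iff, subset_iff, mem_triangularGrid]
  rw [and_comm (a := ∀ _, _), and_assoc]
  refine and_congr_right fun _ => and_congr_right fun hS => ?_
  simp only [← forall_and]
  refine forall₂_congr fun p hp => forall₂_congr fun q hq => forall₂_congr fun r hr =>
    forall₃_congr fun _ _ _ => ?_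
  have hp := hS p hp
  have hq := hS q hq
  have hr := hS r hr
  omega

lemma a194478_eq_zero {n : ℕ} (hn : #(triangularGrid n) < 6) : a194478 n = 0 := by
  rw [a194478, Nat.card_eq_zero]
  refine Or.inl ⟨fun ⟨S, h6, hS, _⟩ => ?_⟩
  have := card_le_card fun p hp => mem_triangularGrid.2 (hS p hp)
  omega

end GridCount

/-- Closed form for `a194478`. -/
theorem stmt19 (n : ℕ) (hn : 1 ≤ n) :
    (a194478 n : ℚ) =
      (1 / 256) * (-1) ^ n * (2 * (n : ℚ) - 7) * ((n : ℚ) ^ 2 - 7 * (n : ℚ) + 13) +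
      (1 / 322560) * (7 * (n : ℚ) ^ 12 + 42 * (n : ℚ) ^ 11 - 945 * (n : ℚ) ^ 10 +
        1274 * (n : ℚ) ^ 9 + 26089 * (n : ℚ) ^ 8 - 128810 * (n : ℚ) ^ 7 +
        175693 * (n : ℚ) ^ 6 + 205366 * (n : ℚ) ^ 5 - 810796 * (n : ℚ) ^ 4 +
        601328 * (n : ℚ) ^ 3 + 354172 * (n : ℚ) ^ 2 - 582180 * (n : ℚ) + 114660) := by
  obtain ⟨m, rfl⟩ : ∃ m, n = m + 1 := ⟨n - 1, by omega⟩
  rcases lt_or_ge m 2 with hm | hm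
  · interval_cases m
    · rw [a194478_eq_zero (by decide)]; norm_num
    · rw [a194478_eq_zero (by decide)]; norm_num
  · rw [a194478_eq_card, (isSimplex_triangularGrid m).card_good hm]
    push_cast
    rfl
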